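/- There exists a constant c > 0 such that for all integers m ≥ 0 and all real u > 0, Σ_{n > u (m+1)²} φ_{n,m} (2/27)^n ≤ c u^{−3/2} Z_m; equivalently, if Y is the number of internal vertices of a free triangulation of an (m+2)-gon, then μ_m((m+1)^{−2} Y > u) ≤ c u^{−3/2} uniformly in m. -/

import Mathlib

/-- `φ_{n,m}`: the number of rooted type II triangulations of a disc with `m+2`
boundary vertices and `n` internal vertices. -/
noncomputable def phi (n m : ℕ) : ℝ :=
  2 ^ (n + 1) * ((2 * m + 1).factorial : ℝ) * ((2 * m + 3 * n).factorial : ℝ) /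
    (((m.factorial : ℝ)) ^ 2 * ((n.factorial : ℝ)) * (((2 * m + 2 * n + 2).factorial : ℝ)))

/-- `Z_m = ((2m)!/(m!(m+2)!)) (9/4)^{m+1}`, the partition function of free
triangulations of an `(m+2)`-gon (`Z_m = Σ_n φ_{n,m} (2/27)^n`). -/
noncomputable def Zconst (m : ℕ) : ℝ :=
  ((2 * m).factorial : ℝ) / ((m.factorial : ℝ) * ((m + 2).factorial : ℝ)) * (9 / 4) ^ (m + 1)

/-- The normalised weight, without its polynomial factor in `m`. -/
noncomputable def gaux (n m : ℕ) : ℝ :=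
  (4 / 27) ^ n * (4 / 9) ^ m * ((2 * m + 3 * n).factorial : ℝ) /
    ((n.factorial : ℝ) * ((2 * m + 2 * n + 2).factorial : ℝ))

lemma gaux_nonneg (n m : ℕ) : 0 ≤ gaux n m := by unfold gaux; positivity

lemma phi_eq (n m : ℕ) : phi n m * (2 / 27) ^ n =
    8 / 9 * ((2 * m + 1) * (m + 1) * (m + 2)) * gaux n m * Zconst m := by
  unfold phi Zconst gaux
  have h1 : (4 / 27 : ℝ) ^ n = 2 ^ n * (2 / 27) ^ n := by rw [← mul_pow]; norm_num
  have h2 : (9 / 4 : ℝ) ^ m = ((4 / 9 : ℝ) ^ m)⁻¹ := by rw [← inv_pow]; norm_num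
  have h3 : (4 / 9 : ℝ) ^ m ≠ 0 := by positivity
  rw [pow_succ (9 / 4 : ℝ), h2, h1, Nat.factorial_succ (2 * m), Nat.factorial_succ (m + 1),
    Nat.factorial_succ m]
  generalize (4 / 9 : ℝ) ^ m = q at *
  generalize (2 / 27 : ℝ) ^ n = r at *
  have f1 : ((2 * m + 3 * n).factorial : ℝ) ≠ 0 := by positivity
  have f2 : ((2 * m + 2 * n + 2).factorial : ℝ) ≠ 0 := by positivity
  have f3 : ((2 * m).factorial : ℝ) ≠ 0 := by positivity
  have f4 : (m.factorial : ℝ) ≠ 0 := by positivity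
  have f5 : (n.factorial : ℝ) ≠ 0 := by positivity
  have f6 : (m : ℝ) + 1 ≠ 0 := by positivity
  have f7 : (m : ℝ) + 1 + 1 ≠ 0 := by positivity
  generalize (2 * m + 3 * n).factorial = A at *
  generalize (2 * m + 2 * n + 2).factorial = B at *
  generalize (2 * m).factorial = C at *
  generalize m.factorial = D at *
  generalize n.factorial = E at *
  push_cast
  field_simp
  ring

lemma gaux_succ_le (n m : ℕ) : gaux n (m + 1) ≤ gaux n m := by
  have e : gaux n (m + 1) = gaux n m * (4 * ((2 * m + 3 * n + 2) * (2 * m + 3 * n + 1)) /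
      (9 * ((2 * m + 2 * n + 4) * (2 * m + 2 * n + 3)))) := by
    unfold gaux
    rw [show 2 * (m + 1) + 3 * n = (2 * m + 3 * n + 1) + 1 by ring,
      show 2 * (m + 1) + 2 * n + 2 = (2 * m + 2 * n + 2 + 1) + 1 by ring]
    simp only [Nat.factorial_succ (2 * m + 3 * n + 1), Nat.factorial_succ (2 * m + 3 * n),
      Nat.factorial_succ (2 * m + 2 * n + 2 + 1), Nat.factorial_succ (2 * m + 2 * n + 2)]
    have f2 : ((2 * m + 2 * n + 2).factorial : ℝ) ≠ 0 := by positivity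
    have f5 : (n.factorial : ℝ) ≠ 0 := by positivity
    generalize (2 * m + 3 * n).factorial = A at *
    generalize (2 * m + 2 * n + 2).factorial = B at *
    generalize n.factorial = E at *
    rw [pow_succ (4 / 9 : ℝ)]
    generalize (4 / 9 : ℝ) ^ m = q at *
    generalize (4 / 27 : ℝ) ^ n = r at *
    push_cast
    have f6 : (2 * m + 2 * n + 2 + 1 : ℝ) ≠ 0 := by positivity
    have f7 : (2 * m + 2 * n + 2 + 1 + 1 : ℝ) ≠ 0 := by positivity
    have f8 : (2 * m + 2 * n + 4 : ℝ) ≠ 0 := by positivity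
    have f9 : (2 * m + 2 * n + 3 : ℝ) ≠ 0 := by positivity
    rw [show (2 * m + 2 * n + 2 + 1 + 1 : ℝ) = 2 * m + 2 * n + 4 by ring,
      show (2 * m + 2 * n + 2 + 1 : ℝ) = 2 * m + 2 * n + 3 by ring]
    field_simp
    ring
  rw [e]
  apply mul_le_of_le_one_right (gaux_nonneg n m)
  rw [div_le_one (by positivity)]
  have : (0 : ℝ) ≤ m := by positivity
  have : (0 : ℝ) ≤ n := by positivity
  have := mul_le_mul (show 2 * (2 * m + 3 * n + 2 : ℝ) ≤ 3 * (2 * m + 2 * n + 4) by linarith)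
    (show 2 * (2 * m + 3 * n + 1 : ℝ) ≤ 3 * (2 * m + 2 * n + 3) by linarith)
    (by positivity) (by positivity)
  linarith

lemma gaux_le_zero (n m : ℕ) : gaux n m ≤ gaux n 0 := by
  induction m with
  | zero => exact le_rfl
  | succ k ih => exact (gaux_succ_le n k).trans ih

lemma gaux_zero_succ (n : ℕ) : gaux (n + 1) 0 = gaux n 0 *
    (2 * ((3 * n + 1) * (3 * n + 2)) / (9 * ((2 * n + 3) * (n + 2)))) := by
  unfold gaux
  rw [show 2 * 0 + 3 * (n + 1) = (3 * n + 1 + 1) + 1 by ring,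
    show 2 * 0 + 2 * (n + 1) + 2 = (2 * n + 2 + 1) + 1 by ring,
    show 2 * 0 + 3 * n = 3 * n by ring, show 2 * 0 + 2 * n + 2 = 2 * n + 2 by ring]
  simp only [Nat.factorial_succ (3 * n + 1 + 1), Nat.factorial_succ (3 * n + 1),
    Nat.factorial_succ (3 * n), Nat.factorial_succ n,
    Nat.factorial_succ (2 * n + 2 + 1), Nat.factorial_succ (2 * n + 2)]
  have f2 : ((2 * n + 2).factorial : ℝ) ≠ 0 := by positivity
  have f5 : (n.factorial : ℝ) ≠ 0 := by positivity
  generalize (3 * n).factorial = A at *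
  generalize (2 * n + 2).factorial = B at *
  generalize n.factorial = E at *
  rw [pow_succ (4 / 27 : ℝ)]
  generalize (4 / 27 : ℝ) ^ n = r at *
  push_cast
  have f8 : (n + 2 : ℝ) ≠ 0 := by positivity
  have f9 : (2 * n + 3 : ℝ) ≠ 0 := by positivity
  have f10 : (n + 1 : ℝ) ≠ 0 := by positivity
  rw [show (2 * n + 2 + 1 + 1 : ℝ) = 2 * (n + 2) by ring,
    show (2 * n + 2 + 1 : ℝ) = 2 * n + 3 by ring]
  field_simp
  ring

lemma gaux_sq (n : ℕ) : gaux n 0 ^ 2 * (n + 1) ^ 5 ≤ 1 / 4 := by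
  induction n with
  | zero => norm_num [gaux]
  | succ n ih =>
    refine le_trans ?_ ih
    rw [gaux_zero_succ, mul_pow, mul_assoc]
    apply mul_le_mul_of_nonneg_left _ (sq_nonneg _)
    push_cast
    rw [div_pow, div_mul_eq_mul_div, div_le_iff₀ (by positivity)]
    have hn : (0 : ℝ) ≤ n := by positivity
    generalize (n : ℝ) = x at *
    have key : 4 * (3 * x + 1) ^ 2 * (3 * x + 2) ^ 2 * (x + 2) ^ 3 ≤
        81 * (2 * x + 3) ^ 2 * (x + 1) ^ 5 := by
      rw [← sub_nonneg]
      ring_nf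
      positivity
    have := mul_le_mul_of_nonneg_right key (sq_nonneg (x + 2))
    linear_combination this

lemma gaux_bound (n m : ℕ) : gaux n m ≤ 1 / 2 * (1 / √((n : ℝ) + 1) ^ 5) := by
  refine (gaux_le_zero n m).trans ?_
  have hs : 0 < √((n : ℝ) + 1) := by positivity
  have h := gaux_sq n
  rw [mul_one_div, le_div_iff₀ (by positivity)]
  refine le_of_sq_le_sq (a := gaux n 0 * √((n : ℝ) + 1) ^ 5) ?_ (by norm_num)
  have e : (√((n : ℝ) + 1) ^ 5) ^ 2 = (n + 1) ^ 5 := by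
    rw [← pow_mul, mul_comm, pow_mul, Real.sq_sqrt (by positivity)]
  rw [mul_pow, e]
  linarith

lemma step (t s : ℝ) (ht : 0 < t) (hts : t ≤ s) (h : s ^ 2 = t ^ 2 + 1) :
    1 / s ^ 5 ≤ 2 * (1 / t ^ 3 - 1 / s ^ 3) := by
  have hs : 0 < s := ht.trans_le hts
  have h1 : (s - t) * (s + t) = 1 := by linear_combination h
  have h2 : s ≤ 2 * (s ^ 3 - t ^ 3) := by
    have h3 : 1 ≤ (s - t) * (2 * s) := by nlinarith
    have : s * 1 ≤ s * ((s - t) * (2 * s)) := mul_le_mul_of_nonneg_left h3 hs.le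
    have : 0 ≤ (s - t) * (s * t + t ^ 2) := mul_nonneg (by linarith) (by positivity)
    nlinarith
  have e : 2 * (1 / t ^ 3 - 1 / s ^ 3) = 2 * (s ^ 3 - t ^ 3) / (t ^ 3 * s ^ 3) := by
    field_simp
  rw [e]
  calc 1 / s ^ 5 = s / (s ^ 3 * s ^ 3) := by field_simp
    _ ≤ s / (t ^ 3 * s ^ 3) := by gcongr
    _ ≤ _ := by gcongr

lemma tail_partial (U : ℝ) (hU : 0 < U) (N : ℕ) :
    ∑ n ∈ Finset.range N, (if U < (n : ℝ) then 1 / √((n : ℝ) + 1) ^ 5 else 0) ≤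
      2 * (1 / √U ^ 3 - 1 / √(max U N) ^ 3) := by
  induction N with
  | zero => simp [hU.le]
  | succ N ih =>
    rw [Finset.sum_range_succ]
    have hsU : 0 < √U := Real.sqrt_pos.2 hU
    split_ifs with h
    · have hN : (0 : ℝ) < N := hU.trans h
      rw [max_eq_right h.le] at ih
      rw [max_eq_right (by push_cast; linarith)]
      have := step (√N) (√(N + 1)) (Real.sqrt_pos.2 hN) (Real.sqrt_le_sqrt (by linarith))
        (by rw [Real.sq_sqrt (by positivity), Real.sq_sqrt hN.le])
      push_cast
      linarith
    · have h5 : 0 < √(max U N) := Real.sqrt_pos.2 (lt_max_of_lt_left hU)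
      have : 1 / √(max U ((N + 1 : ℕ) : ℝ)) ^ 3 ≤ 1 / √(max U N) ^ 3 := by
        gcongr
        simp
      linarith

theorem free_triangulation_size_tail :
    ∃ c : ℝ, 0 < c ∧ ∀ (m : ℕ) (u : ℝ), 0 < u →
      (∑' n : ℕ, if u * ((m : ℝ) + 1) ^ 2 < (n : ℝ) then phi n m * (2 / 27) ^ n else 0) ≤
        c * u ^ (-(3 : ℝ) / 2) * Zconst m := by
  refine ⟨4, by norm_num, fun m u hu => ?_⟩
  have hZ : 0 ≤ Zconst m := by unfold Zconst; positivity
  have hsu : 0 < √u := Real.sqrt_pos.2 hu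
  have hU : 0 < u * ((m : ℝ) + 1) ^ 2 := by positivity
  have hpow : u ^ (-(3 : ℝ) / 2) = 1 / √u ^ 3 := by
    rw [Real.sqrt_eq_rpow, ← Real.rpow_natCast, ← Real.rpow_mul hu.le, one_div,
      ← Real.rpow_neg hu.le]
    norm_num
  have hsU : √(u * ((m : ℝ) + 1) ^ 2) = √u * (m + 1) := by
    rw [Real.sqrt_mul hu.le, Real.sqrt_sq (by positivity)]
  have hterm : ∀ n : ℕ, phi n m * (2 / 27) ^ n ≤
      2 * ((m : ℝ) + 1) ^ 3 * Zconst m * (1 / √((n : ℝ) + 1) ^ 5) := by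
    intro n
    rw [phi_eq]
    have hm : (0 : ℝ) ≤ m := by positivity
    have h1 : 8 / 9 * ((2 * (m : ℝ) + 1) * (m + 1) * (m + 2)) ≤ 4 * ((m : ℝ) + 1) ^ 3 := by
      rw [← sub_nonneg]; ring_nf; positivity
    calc _ ≤ 4 * ((m : ℝ) + 1) ^ 3 * (1 / 2 * (1 / √((n : ℝ) + 1) ^ 5)) * Zconst m :=
          mul_le_mul_of_nonneg_right
            (mul_le_mul h1 (gaux_bound n m) (gaux_nonneg n m) (by positivity)) hZ
      _ = _ := by ring
  apply Real.tsum_le_of_sum_range_le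
  · intro n
    split_ifs
    · unfold phi; positivity
    · exact le_rfl
  intro N
  calc _ ≤ ∑ n ∈ Finset.range N, 2 * ((m : ℝ) + 1) ^ 3 * Zconst m *
        (if u * ((m : ℝ) + 1) ^ 2 < (n : ℝ) then 1 / √((n : ℝ) + 1) ^ 5 else 0) := by
        apply Finset.sum_le_sum
        intro n _
        split_ifs
        · exact hterm n
        · simp
    _ = 2 * ((m : ℝ) + 1) ^ 3 * Zconst m * ∑ n ∈ Finset.range N,
        (if u * ((m : ℝ) + 1) ^ 2 < (n : ℝ) then 1 / √((n : ℝ) + 1) ^ 5 else 0) := by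
        rw [Finset.mul_sum]
    _ ≤ 2 * ((m : ℝ) + 1) ^ 3 * Zconst m * (2 * (1 / √(u * ((m : ℝ) + 1) ^ 2) ^ 3)) := by
        apply mul_le_mul_of_nonneg_left _ (by positivity)
        refine (tail_partial _ hU N).trans ?_
        have : 0 ≤ 1 / √(max (u * ((m : ℝ) + 1) ^ 2) N) ^ 3 := by positivity
        linarith
    _ = _ := by
        rw [hpow, hsU]
        field_simp
        ring
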